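/- arXiv:math/9604231 — 2 statements merged into one kernel-verified Lean document; each statement's English description precedes it below -/
import Mathlib

section
/- Let K be the normalized complete elliptic integral of the first kind, H(x) = exp(-π K(1-x)/K(x)) for 0 < x < 1, and Γ(ν) = 1 + 8 Σ_{k=1}^{∞} (-1)^k k ν^k/(1+ν^k). Then Γ(H(x)) = K(x)²(1-x) for all 0 < x < 1; in particular Γ(ν) > 0 for all 0 < ν < 1. -/
noncomputable def K (x : ℝ) : ℝ :=
  (2 / Real.pi) * ∫ τ in (0 : ℝ)..(Real.pi / 2),
    (1 - x * Real.sin τ ^ 2) ^ (-(1/2) : ℝ)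

noncomputable def H (x : ℝ) : ℝ := Real.exp (-Real.pi * K (1 - x) / K x)

noncomputable def Γ' (ν : ℝ) : ℝ :=
  1 + 8 * ∑' k : ℕ, (-1) ^ (k + 1) * ((k : ℝ) + 1) * ν ^ (k + 1) / (1 + ν ^ (k + 1))

theorem tsum_int_prod_eq_add_rotated {f : ℤ × ℤ → ℝ} (hf : Summable f) :
    ∑' p, f p = ∑' p : ℤ × ℤ, f (p.1 + p.2, p.1 - p.2)
      + ∑' p : ℤ × ℤ, f (p.1 + p.2 + 1, p.1 - p.2) := by
  have hi₀ : Function.Injective fun p : ℤ × ℤ => (p.1 + p.2, p.1 - p.2) := by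
    rintro ⟨a, b⟩ ⟨c, d⟩ h
    simp only [Prod.mk.injEq] at h ⊢
    omega
  have hi₁ : Function.Injective fun p : ℤ × ℤ => (p.1 + p.2 + 1, p.1 - p.2) := by
    rintro ⟨a, b⟩ ⟨c, d⟩ h
    simp only [Prod.mk.injEq] at h ⊢
    omega
  have hc : IsCompl (Set.range fun p : ℤ × ℤ => (p.1 + p.2, p.1 - p.2))
      (Set.range fun p : ℤ × ℤ => (p.1 + p.2 + 1, p.1 - p.2)) := by
    constructor
    · rw [Set.disjoint_left]
      rintro _ ⟨⟨a, b⟩, rfl⟩ ⟨⟨c, d⟩, h⟩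
      simp only [Prod.mk.injEq] at h
      omega
    · rw [codisjoint_iff_le_sup]
      rintro ⟨m, n⟩ -
      rcases Int.even_or_odd' (m + n) with ⟨k, hk | hk⟩
      · exact Or.inl ⟨(k, m - k), by simp only [Prod.mk.injEq]; omega⟩
      · exact Or.inr ⟨(k, m - k - 1), by simp only [Prod.mk.injEq]; omega⟩
  have h₀ := (hf.comp_injective hi₀).hasSum
  have h₁ := (hf.comp_injective hi₁).hasSum
  exact (HasSum.add_isCompl hc (hi₀.hasSum_range_iff.2 h₀) (hi₁.hasSum_range_iff.2 h₁)).tsum_eq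

/-- The theta series `∑ q ^ (n ^ 2)`. -/
noncomputable def thetaSeries (q : ℝ) : ℝ := ∑' n : ℤ, q ^ (n ^ 2)

/-- The alternating theta series `∑ (-1) ^ n * q ^ (n ^ 2)`. -/
noncomputable def altThetaSeries (q : ℝ) : ℝ := ∑' n : ℤ, (-1) ^ n * q ^ (n ^ 2)

/-- The theta series `∑ q ^ (n ^ 2 + n)`. -/
noncomputable def shiftedThetaSeries (q : ℝ) : ℝ := ∑' n : ℤ, q ^ (n ^ 2 + n)

theorem summable_pow_natAbs {q : ℝ} (h₀ : 0 ≤ q) (h₁ : q < 1) :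
    Summable fun n : ℤ => q ^ n.natAbs := by
  rw [summable_int_iff_summable_nat_and_neg]
  simpa using summable_geometric_of_lt_one h₀ h₁

theorem zpow_sq_le_pow_natAbs {q : ℝ} (h₀ : 0 < q) (h₁ : q < 1) (n : ℤ) :
    q ^ (n ^ 2) ≤ q ^ n.natAbs := by
  rw [← zpow_natCast]
  refine zpow_le_zpow_right_of_le_one₀ h₀ h₁.le ?_
  simpa using Int.natAbs_le_self_sq n

theorem summable_zpow_sq {q : ℝ} (h₀ : 0 < q) (h₁ : q < 1) :
    Summable fun n : ℤ => q ^ (n ^ 2) :=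
  (summable_pow_natAbs h₀.le h₁).of_nonneg_of_le (fun _ => by positivity)
    (zpow_sq_le_pow_natAbs h₀ h₁)

theorem norm_neg_one_zpow_mul {q : ℝ} (h₀ : 0 < q) (m n : ℤ) :
    ‖(-1 : ℝ) ^ m * q ^ n‖ = q ^ n := by
  rw [norm_mul, norm_zpow, norm_neg, norm_one, one_zpow, one_mul, Real.norm_of_nonneg]
  positivity

theorem summable_neg_one_zpow_mul_zpow_sq {q : ℝ} (h₀ : 0 < q) (h₁ : q < 1) :
    Summable fun n : ℤ => (-1) ^ n * q ^ (n ^ 2) :=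
  .of_norm <| by simpa only [norm_neg_one_zpow_mul h₀] using summable_zpow_sq h₀ h₁

theorem summable_zpow_sq_add_self {q : ℝ} (h₀ : 0 < q) (h₁ : q < 1) :
    Summable fun n : ℤ => q ^ (n ^ 2 + n) := by
  refine ((summable_pow_natAbs h₀.le h₁).mul_left q⁻¹).of_nonneg_of_le
    (fun _ => by positivity) fun n => ?_
  rw [← zpow_natCast, ← zpow_neg_one, ← zpow_add₀ h₀.ne']
  refine zpow_le_zpow_right_of_le_one₀ h₀ h₁.le ?_
  rcases le_total 0 n with h | h
  · rw [Int.natAbs_of_nonneg h]; nlinarith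
  · rw [Int.ofNat_natAbs_of_nonpos h]; nlinarith [sq_nonneg (n + 1)]

theorem thetaSeries_pos {q : ℝ} (h₀ : 0 < q) (h₁ : q < 1) : 0 < thetaSeries q :=
  (summable_zpow_sq h₀ h₁).tsum_pos (fun _ => by positivity) 0 (by positivity)

theorem shiftedThetaSeries_pos {q : ℝ} (h₀ : 0 < q) (h₁ : q < 1) : 0 < shiftedThetaSeries q :=
  (summable_zpow_sq_add_self h₀ h₁).tsum_pos (fun _ => by positivity) 0 (by positivity)

theorem tsum_mul_tsum_eq_add_rotated {f g : ℤ → ℝ} (hf : Summable f) (hg : Summable g) :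
    (∑' n, f n) * ∑' n, g n = ∑' p : ℤ × ℤ, f (p.1 + p.2) * g (p.1 - p.2)
      + ∑' p : ℤ × ℤ, f (p.1 + p.2 + 1) * g (p.1 - p.2) := by
  rw [tsum_mul_tsum_of_summable_norm hf.norm hg.norm]
  exact tsum_int_prod_eq_add_rotated (summable_mul_of_summable_norm hf.norm hg.norm)

section Duplication

variable {q : ℝ} (h₀ : 0 < q) (h₁ : q < 1)
include h₀ h₁

theorem thetaSeries_sq :
    thetaSeries q ^ 2 = thetaSeries (q ^ 2) ^ 2 + q * shiftedThetaSeries (q ^ 2) ^ 2 := by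
  have h₂ : 0 < q ^ 2 := by positivity
  have h₃ : q ^ 2 < 1 := pow_lt_one₀ h₀.le h₁ two_ne_zero
  have hs := summable_zpow_sq h₂ h₃
  have hc := summable_zpow_sq_add_self h₂ h₃
  rw [sq (thetaSeries q), sq (thetaSeries (q ^ 2)), sq (shiftedThetaSeries _), thetaSeries,
    tsum_mul_tsum_eq_add_rotated (summable_zpow_sq h₀ h₁) (summable_zpow_sq h₀ h₁), thetaSeries,
    shiftedThetaSeries, tsum_mul_tsum_of_summable_norm hs.norm hs.norm,
    tsum_mul_tsum_of_summable_norm hc.norm hc.norm, ← tsum_mul_left]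
  simp only [← zpow_natCast q 2, ← zpow_mul, ← zpow_add₀ h₀.ne', ← zpow_one_add₀ h₀.ne']
  refine congrArg₂ (· + ·) (tsum_congr fun p => congrArg _ ?_) (tsum_congr fun p => congrArg _ ?_)
    <;> push_cast <;> ring

theorem altThetaSeries_sq :
    altThetaSeries q ^ 2 = thetaSeries (q ^ 2) ^ 2 - q * shiftedThetaSeries (q ^ 2) ^ 2 := by
  have h₂ : 0 < q ^ 2 := by positivity
  have h₃ : q ^ 2 < 1 := pow_lt_one₀ h₀.le h₁ two_ne_zero
  have hs := summable_zpow_sq h₂ h₃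
  have hc := summable_zpow_sq_add_self h₂ h₃
  have ha := summable_neg_one_zpow_mul_zpow_sq h₀ h₁
  rw [sq (altThetaSeries q), sq (thetaSeries (q ^ 2)), sq (shiftedThetaSeries _), altThetaSeries,
    tsum_mul_tsum_eq_add_rotated ha ha, thetaSeries,
    shiftedThetaSeries, tsum_mul_tsum_of_summable_norm hs.norm hs.norm,
    tsum_mul_tsum_of_summable_norm hc.norm hc.norm, ← tsum_mul_left, sub_eq_add_neg, ← tsum_neg]
  have hsgn (m n : ℤ) : ((-1 : ℝ) ^ (m + n)) * (-1) ^ (m - n) = 1 := by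
    rw [← zpow_add₀ (by norm_num), show m + n + (m - n) = 2 * m by ring, zpow_mul]; norm_num
  have hsgn' (m n : ℤ) : ((-1 : ℝ) ^ (m + n + 1)) * (-1) ^ (m - n) = -1 := by
    rw [zpow_add_one₀ (by norm_num), mul_right_comm, hsgn]; norm_num
  simp only [mul_mul_mul_comm _ (q ^ (_ : ℤ)), hsgn, hsgn', one_mul, neg_one_mul,
    ← zpow_natCast q 2, ← zpow_mul, ← zpow_add₀ h₀.ne', ← zpow_one_add₀ h₀.ne']
  refine congrArg₂ (· + ·) (tsum_congr fun p => congrArg _ ?_)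
    (tsum_congr fun p => congrArg _ (congrArg _ ?_)) <;> push_cast <;> ring

theorem shiftedThetaSeries_sq :
    shiftedThetaSeries q ^ 2 = 2 * (shiftedThetaSeries (q ^ 2) * thetaSeries (q ^ 2)) := by
  have h₂ : 0 < q ^ 2 := by positivity
  have h₃ : q ^ 2 < 1 := pow_lt_one₀ h₀.le h₁ two_ne_zero
  have hs := summable_zpow_sq h₂ h₃
  have hc := summable_zpow_sq_add_self h₂ h₃
  have hc' := summable_zpow_sq_add_self h₀ h₁
  have hshift : thetaSeries (q ^ 2) = ∑' n : ℤ, (q ^ 2) ^ ((n + 1) ^ 2) := by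
    rw [thetaSeries, ← (Equiv.addRight (1 : ℤ)).tsum_eq]
    rfl
  have hs' : Summable fun n : ℤ => (q ^ 2) ^ ((n + 1) ^ 2) :=
    hs.comp_injective (add_left_injective (1 : ℤ))
  have hl : shiftedThetaSeries (q ^ 2) * thetaSeries (q ^ 2) =
      ∑' p : ℤ × ℤ, q ^ ((p.1 + p.2) ^ 2 + (p.1 + p.2)) * q ^ ((p.1 - p.2) ^ 2 + (p.1 - p.2)) := by
    rw [shiftedThetaSeries, thetaSeries, tsum_mul_tsum_of_summable_norm hc.norm hs.norm]
    simp only [← zpow_natCast q 2, ← zpow_mul, ← zpow_add₀ h₀.ne']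
    refine tsum_congr fun p => congrArg _ ?_
    push_cast
    ring
  have hr : thetaSeries (q ^ 2) * shiftedThetaSeries (q ^ 2) =
      ∑' p : ℤ × ℤ, q ^ ((p.1 + p.2 + 1) ^ 2 + (p.1 + p.2 + 1)) *
        q ^ ((p.1 - p.2) ^ 2 + (p.1 - p.2)) := by
    rw [hshift, shiftedThetaSeries, tsum_mul_tsum_of_summable_norm hs'.norm hc.norm]
    simp only [← zpow_natCast q 2, ← zpow_mul, ← zpow_add₀ h₀.ne']
    refine tsum_congr fun p => congrArg _ ?_
    push_cast
    ring
  rw [two_mul]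
  nth_rw 2 [mul_comm]
  rw [hl, hr, sq, shiftedThetaSeries]
  exact tsum_mul_tsum_eq_add_rotated hc' hc'

theorem thetaSeries_mul_altThetaSeries :
    thetaSeries q * altThetaSeries q = altThetaSeries (q ^ 2) ^ 2 := by
  have h₂ : 0 < q ^ 2 := by positivity
  have h₃ : q ^ 2 < 1 := pow_lt_one₀ h₀.le h₁ two_ne_zero
  have ha := summable_neg_one_zpow_mul_zpow_sq h₀ h₁
  have ha' := summable_neg_one_zpow_mul_zpow_sq h₂ h₃
  have hcancel : ∑' p : ℤ × ℤ, q ^ ((p.1 + p.2 + 1) ^ 2) *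
      ((-1) ^ (p.1 - p.2) * q ^ ((p.1 - p.2) ^ 2)) = 0 := by
    have h := ((Equiv.refl ℤ).prodCongr (Equiv.subLeft (-1 : ℤ))).tsum_eq fun p : ℤ × ℤ =>
      q ^ ((p.1 + p.2 + 1) ^ 2) * ((-1) ^ (p.1 - p.2) * q ^ ((p.1 - p.2) ^ 2))
    rw [← self_eq_neg, ← tsum_neg]
    nth_rw 1 [← h]
    refine tsum_congr fun p => ?_
    simp only [Equiv.prodCongr_apply, Prod.map, Equiv.refl_apply, Equiv.subLeft_apply]
    rw [show p.1 - (-1 - p.2) = p.1 - p.2 + 2 * p.2 + 1 by ring, zpow_add_one₀ (by norm_num),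
      zpow_add₀ (by norm_num), zpow_mul, show p.1 + (-1 - p.2) + 1 = p.1 - p.2 by ring,
      show p.1 - p.2 + 2 * p.2 + 1 = p.1 + p.2 + 1 by ring]
    norm_num
    ring
  rw [sq, thetaSeries, altThetaSeries, tsum_mul_tsum_eq_add_rotated (summable_zpow_sq h₀ h₁) ha,
    hcancel, add_zero, altThetaSeries, tsum_mul_tsum_of_summable_norm ha'.norm ha'.norm]
  have hsgn (m n : ℤ) : (-1 : ℝ) ^ (m - n) = (-1) ^ m * (-1) ^ n := by
    rw [zpow_sub₀ (by norm_num), div_eq_mul_inv, ← inv_zpow, inv_neg_one]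
  refine tsum_congr fun p => ?_
  rw [hsgn, mul_left_comm, mul_mul_mul_comm _ ((q ^ 2) ^ (_ : ℤ))]
  simp only [← zpow_natCast q 2, ← zpow_mul, ← zpow_add₀ h₀.ne']
  congr 2; push_cast; ring

end Duplication

theorem one_sub_mul_sin_sq_pos {x : ℝ} (hx : x < 1) (τ : ℝ) : 0 < 1 - x * Real.sin τ ^ 2 := by
  rcases le_total x 0 with h | h
  · nlinarith [sq_nonneg (Real.sin τ)]
  · nlinarith [Real.sin_sq_le_one τ]

theorem K_eq_integral_inv_sqrt {x : ℝ} (hx : x < 1) :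
    K x = 2 / Real.pi * ∫ τ in (0 : ℝ)..(Real.pi / 2), (√(1 - x * Real.sin τ ^ 2))⁻¹ := by
  simp only [K, Real.rpow_neg (one_sub_mul_sin_sq_pos hx _).le, ← Real.sqrt_eq_rpow]

theorem continuous_inv_sqrt_one_sub_mul_sin_sq {x : ℝ} (hx : x < 1) :
    Continuous fun τ : ℝ => (√(1 - x * Real.sin τ ^ 2))⁻¹ :=
  Continuous.inv₀ (by fun_prop) fun τ => (Real.sqrt_pos.2 (one_sub_mul_sin_sq_pos hx τ)).ne'

theorem one_le_K {x : ℝ} (h₀ : 0 ≤ x) (h₁ : x < 1) : 1 ≤ K x := by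
  have h : ∫ _ in (0 : ℝ)..(Real.pi / 2), (1 : ℝ) ≤
      ∫ τ in (0 : ℝ)..(Real.pi / 2), (√(1 - x * Real.sin τ ^ 2))⁻¹ := by
    refine intervalIntegral.integral_mono (by positivity) (by simp)
      ((continuous_inv_sqrt_one_sub_mul_sin_sq h₁).intervalIntegrable _ _) fun τ => ?_
    refine (one_le_inv₀ (Real.sqrt_pos.2 (one_sub_mul_sin_sq_pos h₁ τ))).2 ?_
    exact Real.sqrt_le_one.2 (by nlinarith [mul_nonneg h₀ (sq_nonneg (Real.sin τ))])
  rw [intervalIntegral.integral_const, smul_eq_mul, mul_one, sub_zero] at h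
  rw [K_eq_integral_inv_sqrt h₁]
  calc (1 : ℝ) = 2 / Real.pi * (Real.pi / 2) := by field_simp
    _ ≤ _ := by gcongr

theorem K_le_inv_sqrt {x : ℝ} (h₀ : 0 ≤ x) (h₁ : x < 1) : K x ≤ (√(1 - x))⁻¹ := by
  have h : ∫ τ in (0 : ℝ)..(Real.pi / 2), (√(1 - x * Real.sin τ ^ 2))⁻¹ ≤
      ∫ _ in (0 : ℝ)..(Real.pi / 2), (√(1 - x))⁻¹ := by
    refine intervalIntegral.integral_mono (by positivity)
      ((continuous_inv_sqrt_one_sub_mul_sin_sq h₁).intervalIntegrable _ _) (by simp) fun τ => ?_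
    have : 0 < √(1 - x) := Real.sqrt_pos.2 (by linarith)
    dsimp only
    gcongr
    exact mul_le_of_le_one_right h₀ (Real.sin_sq_le_one τ)
  rw [intervalIntegral.integral_const, smul_eq_mul, sub_zero] at h
  rw [K_eq_integral_inv_sqrt h₁]
  calc _ ≤ 2 / Real.pi * (Real.pi / 2 * (√(1 - x))⁻¹) := by gcongr
    _ = _ := by field_simp

theorem tendsto_K_nhdsGE_zero : Filter.Tendsto K (nhdsWithin 0 (Set.Ici 0)) (nhds 1) := by
  have hu : Filter.Tendsto (fun x : ℝ => (√(1 - x))⁻¹) (nhdsWithin 0 (Set.Ici 0)) (nhds 1) := by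
    have : ContinuousAt (fun x : ℝ => (√(1 - x))⁻¹) 0 :=
      ContinuousAt.inv₀ (by fun_prop) (by simp)
    simpa using this.tendsto.mono_left nhdsWithin_le_nhds
  have hmem : ∀ᶠ x : ℝ in nhdsWithin 0 (Set.Ici 0), 0 ≤ x ∧ x < 1 :=
    (eventually_mem_nhdsWithin.and (nhdsWithin_le_nhds (Iio_mem_nhds one_pos)))
  exact tendsto_of_tendsto_of_tendsto_of_le_of_le' tendsto_const_nhds hu
    (hmem.mono fun x hx => one_le_K hx.1 hx.2) (hmem.mono fun x hx => K_le_inv_sqrt hx.1 hx.2)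

section Landen

variable {k : ℝ} (h₀ : 0 ≤ k) (h₁ : k < 1)
include h₀ h₁

theorem one_add_sq_add_two_mul_mul_cos_pos (φ : ℝ) :
    0 < 1 + k ^ 2 + 2 * k * Real.cos φ := by
  nlinarith [mul_le_mul_of_nonneg_left (Real.neg_one_le_cos φ) h₀, sq_pos_of_pos (sub_pos.2 h₁)]

/-- Landen's substitution `φ = θ + arcsin (k * sin θ)`. -/
theorem integral_landen_substitution :
    ∫ φ in (0 : ℝ)..Real.pi, (√(1 + k ^ 2 + 2 * k * Real.cos φ))⁻¹ =
      ∫ θ in (0 : ℝ)..Real.pi, (√(1 - k ^ 2 * Real.sin θ ^ 2))⁻¹ := by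
  have hk : k ^ 2 < 1 := pow_lt_one₀ h₀ h₁ two_ne_zero
  have habs (θ : ℝ) : |k * Real.sin θ| < 1 := by
    rw [abs_mul, abs_of_nonneg h₀]
    nlinarith [Real.abs_sin_le_one θ, abs_nonneg (Real.sin θ)]
  have hpos (θ : ℝ) := one_sub_mul_sin_sq_pos hk θ
  have hsqrt (θ : ℝ) : 0 < √(1 - k ^ 2 * Real.sin θ ^ 2) := Real.sqrt_pos.2 (hpos θ)
  have hderiv (θ : ℝ) : HasDerivAt (fun θ => θ + Real.arcsin (k * Real.sin θ))
      (1 + k * Real.cos θ / √(1 - k ^ 2 * Real.sin θ ^ 2)) θ := by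
    have h := (Real.hasDerivAt_arcsin (abs_lt.1 (habs θ)).1.ne' (abs_lt.1 (habs θ)).2.ne).comp θ
      ((Real.hasDerivAt_sin θ).const_mul k)
    refine ((hasDerivAt_id θ).add h).congr_deriv ?_
    rw [mul_pow]
    ring
  have hnum (θ : ℝ) : 0 < √(1 - k ^ 2 * Real.sin θ ^ 2) + k * Real.cos θ := by
    have : |k * Real.cos θ| < √(1 - k ^ 2 * Real.sin θ ^ 2) := by
      refine Real.lt_sqrt_of_sq_lt ?_
      rw [sq_abs, mul_pow, Real.cos_sq']
      linarith
    linarith [(abs_lt.1 this).1]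
  have hroot (θ : ℝ) : √(1 + k ^ 2 + 2 * k * Real.cos (θ + Real.arcsin (k * Real.sin θ))) =
      √(1 - k ^ 2 * Real.sin θ ^ 2) + k * Real.cos θ := by
    rw [Real.sqrt_eq_iff_mul_self_eq_of_pos (hnum θ), Real.cos_add, Real.cos_arcsin,
      Real.sin_arcsin (abs_lt.1 (habs θ)).1.le (abs_lt.1 (habs θ)).2.le, mul_pow]
    have h := Real.sq_sqrt (hpos θ).le
    have h' := Real.sin_sq_add_cos_sq θ
    linear_combination h + k ^ 2 * h'
  have h := intervalIntegral.integral_comp_mul_deriv (a := 0) (b := Real.pi)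
    (g := fun φ => (√(1 + k ^ 2 + 2 * k * Real.cos φ))⁻¹) (fun θ _ => hderiv θ)
    (Continuous.continuousOn (continuous_const.add
      (Continuous.div (by fun_prop) (by fun_prop) fun θ => (hsqrt θ).ne')))
    (Continuous.inv₀ (by fun_prop) fun φ =>
      (Real.sqrt_pos.2 (one_add_sq_add_two_mul_mul_cos_pos h₀ h₁ φ)).ne')
  simp only [Real.sin_zero, Real.sin_pi, mul_zero, Real.arcsin_zero, add_zero] at h
  rw [← h]
  refine intervalIntegral.integral_congr fun θ _ => ?_
  simp only [Function.comp_apply, hroot]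
  have := hsqrt θ
  have := hnum θ
  field_simp

/-- Landen's transformation of the complete elliptic integral of the first kind. -/
theorem K_landen : K (4 * k / (1 + k) ^ 2) = (1 + k) * K (k ^ 2) := by
  have hk : k ^ 2 < 1 := pow_lt_one₀ h₀ h₁ two_ne_zero
  have hx : 4 * k / (1 + k) ^ 2 < 1 := by
    rw [div_lt_one (by positivity)]
    nlinarith [sq_pos_of_pos (sub_pos.2 h₁)]
  have hcont := continuous_inv_sqrt_one_sub_mul_sin_sq hk
  have hdouble := intervalIntegral.integral_comp_mul_left (a := 0) (b := Real.pi / 2)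
    (fun φ => (√(1 + k ^ 2 + 2 * k * Real.cos φ))⁻¹) (two_ne_zero (α := ℝ))
  rw [mul_zero, mul_div_cancel₀ _ two_ne_zero, integral_landen_substitution h₀ h₁,
    ← intervalIntegral.integral_add_adjacent_intervals (hcont.intervalIntegrable 0 (Real.pi / 2))
      (hcont.intervalIntegrable (Real.pi / 2) Real.pi)] at hdouble
  have hreflect := intervalIntegral.integral_comp_sub_left (a := 0) (b := Real.pi / 2)
    (fun θ => (√(1 - k ^ 2 * Real.sin θ ^ 2))⁻¹) Real.pi
  simp only [Real.sin_pi_sub, sub_zero, sub_half] at hreflect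
  rw [← hreflect, smul_eq_mul, ← two_mul, inv_mul_cancel_left₀ two_ne_zero] at hdouble
  rw [K_eq_integral_inv_sqrt hx, K_eq_integral_inv_sqrt hk, ← hdouble,
    mul_left_comm (1 + k), ← intervalIntegral.integral_const_mul (1 + k)]
  congr 1
  refine intervalIntegral.integral_congr fun τ _ => ?_
  have h : 1 + k ^ 2 + 2 * k * Real.cos (2 * τ) =
      (1 + k) ^ 2 * (1 - 4 * k / (1 + k) ^ 2 * Real.sin τ ^ 2) := by
    rw [Real.cos_two_mul, Real.cos_sq']
    field_simp
    ring
  simp only [h]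
  rw [Real.sqrt_mul (by positivity), Real.sqrt_sq (by positivity), mul_inv,
    mul_inv_cancel_left₀ (by positivity)]

end Landen

theorem continuousOn_tsum_mul_zpow_sq {s : ℤ → ℝ} (hs : ∀ n, ‖s n‖ ≤ 1) :
    ContinuousOn (fun q : ℝ => ∑' n : ℤ, s n * q ^ (n ^ 2)) (Set.Ioo 0 1) := by
  intro q hq
  obtain ⟨ρ, hqρ, hρ⟩ := exists_between hq.2
  have h : ContinuousOn (fun q : ℝ => ∑' n : ℤ, s n * q ^ (n ^ 2)) (Set.Ioo 0 ρ) := by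
    refine continuousOn_tsum (fun n => ContinuousOn.const_mul (fun y hy => ?_) _)
      (summable_pow_natAbs (hq.1.trans hqρ).le hρ) fun n y hy => ?_
    · exact (continuousAt_zpow₀ y _ (Or.inl hy.1.ne')).continuousWithinAt
    · rw [norm_mul, Real.norm_of_nonneg (zpow_nonneg hy.1.le _)]
      refine (mul_le_of_le_one_left (zpow_nonneg hy.1.le _) (hs n)).trans ?_
      exact (zpow_sq_le_pow_natAbs hy.1 (hy.2.trans hρ) n).trans
        (pow_le_pow_left₀ hy.1.le hy.2.le _)
  exact (h.continuousAt (Ioo_mem_nhds hq.1 hqρ)).continuousWithinAt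

theorem tendsto_tsum_mul_zpow_sq {s : ℤ → ℝ} (hs : ∀ n, ‖s n‖ ≤ 1) :
    Filter.Tendsto (fun q : ℝ => ∑' n : ℤ, s n * q ^ (n ^ 2)) (nhdsWithin 0 (Set.Ioi 0))
      (nhds (s 0)) := by
  have hsum : ∑' n : ℤ, (if n = 0 then s 0 else 0) = s 0 := tsum_ite_eq 0 _
  rw [← hsum]
  have hmem : ∀ᶠ q : ℝ in nhdsWithin 0 (Set.Ioi 0), 0 < q ∧ q < 1 / 2 :=
    eventually_mem_nhdsWithin.and (nhdsWithin_le_nhds (Iio_mem_nhds (by norm_num)))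
  refine tendsto_tsum_of_dominated_convergence
    (summable_pow_natAbs (q := 1 / 2) (by norm_num) (by norm_num)) (fun n => ?_)
    (hmem.mono fun y hy n => ?_)
  · split_ifs with hn
    · simp [hn]
    · have hpow : Filter.Tendsto (fun q : ℝ => q ^ (n ^ 2).toNat) (nhds 0) (nhds 0) := by
        have h0 : (n ^ 2).toNat ≠ 0 := by
          have : 0 < n ^ 2 := by positivity
          omega
        have h := (continuous_pow (M := ℝ) (n ^ 2).toNat).tendsto 0
        rwa [zero_pow h0] at h
      have h := (hpow.mono_left (nhdsWithin_le_nhds (s := Set.Ioi 0))).const_mul (s n)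
      rw [mul_zero] at h
      refine h.congr fun y => ?_
      rw [← zpow_natCast, Int.toNat_of_nonneg (sq_nonneg n)]
  · rw [norm_mul, Real.norm_of_nonneg (zpow_nonneg hy.1.le _)]
    refine (mul_le_of_le_one_left (zpow_nonneg hy.1.le _) (hs n)).trans ?_
    exact (zpow_sq_le_pow_natAbs hy.1 (by linarith) n).trans
      (pow_le_pow_left₀ hy.1.le hy.2.le _)

theorem continuousOn_thetaSeries : ContinuousOn thetaSeries (Set.Ioo 0 1) := by
  simpa only [one_mul] using! continuousOn_tsum_mul_zpow_sq (s := fun _ => 1) (by simp)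

theorem tendsto_thetaSeries :
    Filter.Tendsto thetaSeries (nhdsWithin 0 (Set.Ioi 0)) (nhds 1) := by
  simpa only [one_mul] using! tendsto_tsum_mul_zpow_sq (s := fun _ => 1) (by simp)

theorem continuousOn_altThetaSeries : ContinuousOn altThetaSeries (Set.Ioo 0 1) :=
  continuousOn_tsum_mul_zpow_sq (s := fun n => (-1) ^ n) (by simp)

theorem tendsto_altThetaSeries :
    Filter.Tendsto altThetaSeries (nhdsWithin 0 (Set.Ioi 0)) (nhds 1) := by
  simpa using! tendsto_tsum_mul_zpow_sq (s := fun n => (-1) ^ n) (by simp)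

theorem eq_of_tendsto_of_forall_sq {f : ℝ → ℝ} {L : ℝ}
    (hf : ∀ q ∈ Set.Ioo (0 : ℝ) 1, f (q ^ 2) = f q)
    (hL : Filter.Tendsto f (nhdsWithin 0 (Set.Ioi 0)) (nhds L)) {q : ℝ}
    (hq : q ∈ Set.Ioo (0 : ℝ) 1) : f q = L := by
  have hiter (n : ℕ) : f (q ^ 2 ^ n) = f q := by
    induction n with
    | zero => simp
    | succ n ih =>
      rw [pow_succ, pow_mul, hf _ ⟨pow_pos hq.1 _, pow_lt_one₀ hq.1.le hq.2 (by positivity)⟩, ih]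
  have hlim : Filter.Tendsto (fun n : ℕ => q ^ 2 ^ n) Filter.atTop (nhdsWithin 0 (Set.Ioi 0)) :=
    tendsto_nhdsWithin_iff.2
      ⟨(tendsto_pow_atTop_nhds_zero_of_lt_one hq.1.le hq.2).comp
        (tendsto_pow_atTop_atTop_of_one_lt one_lt_two), .of_forall fun n => pow_pos hq.1 _⟩
  exact tendsto_nhds_unique (tendsto_const_nhds.congr fun n => (hiter n).symm) (hL.comp hlim)

theorem thetaSeries_exp_neg_pi_div_sq {t : ℝ} (ht : 0 < t) :
    thetaSeries (Real.exp (-Real.pi / t)) ^ 2 = t * thetaSeries (Real.exp (-Real.pi * t)) ^ 2 := by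
  have h := Real.tsum_exp_neg_mul_int_sq ht
  have hexp (y : ℝ) (n : ℤ) : Real.exp (y * n ^ 2) = Real.exp y ^ (n ^ 2) := by
    rw [← Real.rpow_intCast, ← Real.exp_mul]
    push_cast
    rfl
  simp only [hexp, ← Real.sqrt_eq_rpow] at h
  rw [thetaSeries, thetaSeries, h, mul_pow, div_pow, Real.sq_sqrt ht.le]
  field_simp

theorem exists_eq_exp_neg_pi_mul {q : ℝ} (hq : q ∈ Set.Ioo (0 : ℝ) 1) :
    ∃ t, 0 < t ∧ q = Real.exp (-Real.pi * t) := by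
  refine ⟨-Real.log q / Real.pi, div_pos (neg_pos.2 (Real.log_neg hq.1 hq.2)) Real.pi_pos, ?_⟩
  rw [neg_mul, mul_div_cancel₀ _ Real.pi_ne_zero, neg_neg, Real.exp_log hq.1]

theorem exp_neg_pi_mul_mem_Ioo {t : ℝ} (ht : 0 < t) :
    Real.exp (-Real.pi * t) ∈ Set.Ioo (0 : ℝ) 1 :=
  ⟨Real.exp_pos _, Real.exp_lt_one_iff.2 (by nlinarith [Real.pi_pos])⟩

theorem exp_neg_pi_div_mem_Ioo {t : ℝ} (ht : 0 < t) :
    Real.exp (-Real.pi / t) ∈ Set.Ioo (0 : ℝ) 1 := by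
  simpa only [div_eq_mul_inv] using exp_neg_pi_mul_mem_Ioo (inv_pos.2 ht)

theorem exp_mul_shiftedThetaSeries_exp_neg_pi_div_sq {t : ℝ} (ht : 0 < t) :
    Real.exp (-Real.pi / (2 * t)) * shiftedThetaSeries (Real.exp (-Real.pi / t)) ^ 2 =
      t * altThetaSeries (Real.exp (-Real.pi * t)) ^ 2 := by
  obtain ⟨hq₀, hq₁⟩ := exp_neg_pi_mul_mem_Ioo ht
  obtain ⟨hs₀, hs₁⟩ := exp_neg_pi_div_mem_Ioo (t := 2 * t) (by positivity)
  have hs := thetaSeries_sq hs₀ hs₁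
  have h2 := thetaSeries_exp_neg_pi_div_sq (t := 2 * t) (by positivity)
  have h1 := thetaSeries_exp_neg_pi_div_sq ht
  have hsq : Real.exp (-Real.pi / (2 * t)) ^ 2 = Real.exp (-Real.pi / t) := by
    rw [← Real.exp_nat_mul]
    congr 1
    push_cast
    field_simp
  have hsq' : Real.exp (-Real.pi * (2 * t)) = Real.exp (-Real.pi * t) ^ 2 := by
    rw [← Real.exp_nat_mul]
    congr 1
    push_cast
    ring
  rw [hsq] at hs
  rw [hsq'] at h2
  linear_combination h2 - hs - h1 - t * thetaSeries_sq hq₀ hq₁ - t * altThetaSeries_sq hq₀ hq₁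

theorem altThetaSeries_ne_zero {q : ℝ} (hq : q ∈ Set.Ioo (0 : ℝ) 1) : altThetaSeries q ≠ 0 := by
  obtain ⟨t, ht, rfl⟩ := exists_eq_exp_neg_pi_mul hq
  intro h
  have h' := exp_mul_shiftedThetaSeries_exp_neg_pi_div_sq ht
  obtain ⟨h₀, h₁⟩ := exp_neg_pi_div_mem_Ioo ht
  have := shiftedThetaSeries_pos h₀ h₁
  rw [h, zero_pow two_ne_zero, mul_zero] at h'
  exact absurd h' (by positivity)

/-- Jacobi's quartic identity. -/
theorem thetaSeries_pow_four {q : ℝ} (h₀ : 0 < q) (h₁ : q < 1) :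
    thetaSeries q ^ 4 = altThetaSeries q ^ 4 + q * shiftedThetaSeries q ^ 4 := by
  have h := shiftedThetaSeries_sq h₀ h₁
  have ha := thetaSeries_sq h₀ h₁
  have hb := altThetaSeries_sq h₀ h₁
  rw [show thetaSeries q ^ 4 = (thetaSeries q ^ 2) ^ 2 by ring,
    show altThetaSeries q ^ 4 = (altThetaSeries q ^ 2) ^ 2 by ring,
    show shiftedThetaSeries q ^ 4 = (shiftedThetaSeries q ^ 2) ^ 2 by ring, h, ha, hb]
  ring

/-- The elliptic parameter (the square of the elliptic modulus) as a function of the nome. -/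
noncomputable def ellipticParameter (q : ℝ) : ℝ :=
  q * shiftedThetaSeries q ^ 4 / thetaSeries q ^ 4

theorem one_sub_ellipticParameter {q : ℝ} (h₀ : 0 < q) (h₁ : q < 1) :
    1 - ellipticParameter q = altThetaSeries q ^ 4 / thetaSeries q ^ 4 := by
  have := thetaSeries_pos h₀ h₁
  rw [ellipticParameter]
  field_simp
  linear_combination thetaSeries_pow_four h₀ h₁

theorem ellipticParameter_mem_Ioo {q : ℝ} (hq : q ∈ Set.Ioo (0 : ℝ) 1) :
    ellipticParameter q ∈ Set.Ioo (0 : ℝ) 1 := by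
  have ha := thetaSeries_pos hq.1 hq.2
  have hb := altThetaSeries_ne_zero hq
  have hc := shiftedThetaSeries_pos hq.1 hq.2
  have := hq.1
  constructor
  · rw [ellipticParameter]; positivity
  · rw [← sub_pos, one_sub_ellipticParameter hq.1 hq.2]; positivity

/-- The elliptic modulus at the nome `q ^ 2`. -/
noncomputable def landenModulus (q : ℝ) : ℝ :=
  q * shiftedThetaSeries (q ^ 2) ^ 2 / thetaSeries (q ^ 2) ^ 2

theorem ellipticParameter_sq (q : ℝ) : ellipticParameter (q ^ 2) = landenModulus q ^ 2 := by
  rw [ellipticParameter, landenModulus]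
  ring

section LandenModulus

variable {q : ℝ} (hq : q ∈ Set.Ioo (0 : ℝ) 1)
include hq

theorem sq_mem_Ioo : q ^ 2 ∈ Set.Ioo (0 : ℝ) 1 :=
  ⟨pow_pos hq.1 2, pow_lt_one₀ hq.1.le hq.2 two_ne_zero⟩

theorem one_add_landenModulus :
    1 + landenModulus q = thetaSeries q ^ 2 / thetaSeries (q ^ 2) ^ 2 := by
  have ha := thetaSeries_pos (sq_mem_Ioo hq).1 (sq_mem_Ioo hq).2
  rw [landenModulus]
  field_simp
  linear_combination -thetaSeries_sq hq.1 hq.2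

theorem one_sub_landenModulus :
    1 - landenModulus q = altThetaSeries q ^ 2 / thetaSeries (q ^ 2) ^ 2 := by
  have ha := thetaSeries_pos (sq_mem_Ioo hq).1 (sq_mem_Ioo hq).2
  rw [landenModulus]
  field_simp
  linear_combination -altThetaSeries_sq hq.1 hq.2

theorem landenModulus_mem_Ioo : landenModulus q ∈ Set.Ioo (0 : ℝ) 1 := by
  have ha := thetaSeries_pos (sq_mem_Ioo hq).1 (sq_mem_Ioo hq).2
  have hb := altThetaSeries_ne_zero hq
  have hc := shiftedThetaSeries_pos (sq_mem_Ioo hq).1 (sq_mem_Ioo hq).2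
  have := hq.1
  constructor
  · rw [landenModulus]; positivity
  · rw [← sub_pos, one_sub_landenModulus hq]; positivity

theorem ellipticParameter_eq_landen :
    ellipticParameter q = 4 * landenModulus q / (1 + landenModulus q) ^ 2 := by
  have ha := thetaSeries_pos hq.1 hq.2
  have ha' := thetaSeries_pos (sq_mem_Ioo hq).1 (sq_mem_Ioo hq).2
  rw [one_add_landenModulus hq, landenModulus, ellipticParameter,
    show shiftedThetaSeries q ^ 4 = (shiftedThetaSeries q ^ 2) ^ 2 by ring,
    shiftedThetaSeries_sq hq.1 hq.2]
  field_simp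
  ring

end LandenModulus

theorem continuousOn_ellipticParameter : ContinuousOn ellipticParameter (Set.Ioo 0 1) := by
  have h : ContinuousOn (fun q => 1 - altThetaSeries q ^ 4 / thetaSeries q ^ 4) (Set.Ioo 0 1) :=
    continuousOn_const.sub ((continuousOn_altThetaSeries.pow 4).div
      (continuousOn_thetaSeries.pow 4) fun q hq => (pow_pos (thetaSeries_pos hq.1 hq.2) 4).ne')
  refine h.congr fun q hq => ?_
  dsimp only
  rw [← one_sub_ellipticParameter hq.1 hq.2, sub_sub_cancel]

theorem eventually_mem_Ioo_nhdsGT_zero :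
    ∀ᶠ q : ℝ in nhdsWithin 0 (Set.Ioi 0), q ∈ Set.Ioo (0 : ℝ) 1 :=
  Ioo_mem_nhdsGT one_pos

theorem tendsto_ellipticParameter :
    Filter.Tendsto ellipticParameter (nhdsWithin 0 (Set.Ioi 0)) (nhds 0) := by
  have h := ((tendsto_altThetaSeries.pow 4).div (tendsto_thetaSeries.pow 4) (by simp)).const_sub 1
  simp only [one_pow, div_one, sub_self] at h
  refine h.congr' (eventually_mem_Ioo_nhdsGT_zero.mono fun q hq => ?_)
  simp only [Pi.div_apply]
  rw [← one_sub_ellipticParameter hq.1 hq.2, sub_sub_cancel]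

/-- Jacobi's inversion formula. -/
theorem K_ellipticParameter {q : ℝ} (hq : q ∈ Set.Ioo (0 : ℝ) 1) :
    K (ellipticParameter q) = thetaSeries q ^ 2 := by
  have hlim : Filter.Tendsto (fun q => K (ellipticParameter q) / thetaSeries q ^ 2)
      (nhdsWithin 0 (Set.Ioi 0)) (nhds 1) := by
    have hx : Filter.Tendsto ellipticParameter (nhdsWithin 0 (Set.Ioi 0))
        (nhdsWithin 0 (Set.Ici 0)) :=
      tendsto_nhdsWithin_iff.2 ⟨tendsto_ellipticParameter,
        eventually_mem_Ioo_nhdsGT_zero.mono fun q hq => (ellipticParameter_mem_Ioo hq).1.le⟩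
    simpa using! (tendsto_K_nhdsGE_zero.comp hx).div (tendsto_thetaSeries.pow 2) (by simp)
  have h := eq_of_tendsto_of_forall_sq (fun y hy => ?_) hlim hq
  · rwa [div_eq_one_iff_eq (pow_pos (thetaSeries_pos hq.1 hq.2) 2).ne'] at h
  · have hk := landenModulus_mem_Ioo hy
    have ha := thetaSeries_pos hy.1 hy.2
    have ha' := thetaSeries_pos (sq_mem_Ioo hy).1 (sq_mem_Ioo hy).2
    rw [ellipticParameter_eq_landen hy, K_landen hk.1.le hk.2, one_add_landenModulus hy,
      ellipticParameter_sq]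
    field_simp

theorem ellipticParameter_exp_neg_pi_div {t : ℝ} (ht : 0 < t) :
    ellipticParameter (Real.exp (-Real.pi / t)) =
      1 - ellipticParameter (Real.exp (-Real.pi * t)) := by
  obtain ⟨hq₀, hq₁⟩ := exp_neg_pi_mul_mem_Ioo ht
  have ha := thetaSeries_pos hq₀ hq₁
  have hc := exp_mul_shiftedThetaSeries_exp_neg_pi_div_sq ht
  have hsq : Real.exp (-Real.pi / t) = Real.exp (-Real.pi / (2 * t)) ^ 2 := by
    rw [← Real.exp_nat_mul]
    congr 1
    push_cast
    field_simp
  rw [one_sub_ellipticParameter hq₀ hq₁, ellipticParameter]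
  have hn : Real.exp (-Real.pi / t) * shiftedThetaSeries (Real.exp (-Real.pi / t)) ^ 4 =
      t ^ 2 * altThetaSeries (Real.exp (-Real.pi * t)) ^ 4 := by
    calc _ = (Real.exp (-Real.pi / (2 * t)) *
          shiftedThetaSeries (Real.exp (-Real.pi / t)) ^ 2) ^ 2 := by rw [mul_pow, ← hsq]; ring
      _ = _ := by rw [hc]; ring
  rw [hn, show thetaSeries (Real.exp (-Real.pi / t)) ^ 4 =
    (thetaSeries (Real.exp (-Real.pi / t)) ^ 2) ^ 2 by ring, thetaSeries_exp_neg_pi_div_sq ht]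
  field_simp

theorem H_ellipticParameter {q : ℝ} (hq : q ∈ Set.Ioo (0 : ℝ) 1) :
    H (ellipticParameter q) = q := by
  obtain ⟨t, ht, rfl⟩ := exists_eq_exp_neg_pi_mul hq
  have ha := thetaSeries_pos hq.1 hq.2
  rw [H, ← ellipticParameter_exp_neg_pi_div ht, K_ellipticParameter (exp_neg_pi_div_mem_Ioo ht),
    K_ellipticParameter hq, thetaSeries_exp_neg_pi_div_sq ht]
  rw [mul_div_assoc, mul_div_assoc, div_self (pow_pos ha 2).ne', mul_one]

theorem surjOn_ellipticParameter :
    Set.SurjOn ellipticParameter (Set.Ioo 0 1) (Set.Ioo 0 1) := by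
  intro x hx
  have hsmall {ε : ℝ} (hε : 0 < ε) : ∃ q ∈ Set.Ioo (0 : ℝ) 1, ellipticParameter q < ε :=
    (eventually_mem_Ioo_nhdsGT_zero.and
      (tendsto_ellipticParameter.eventually (Iio_mem_nhds hε))).exists
  obtain ⟨q₁, hq₁, h₁⟩ := hsmall hx.1
  obtain ⟨q₂, hq₂, h₂⟩ := hsmall (sub_pos.2 hx.2)
  obtain ⟨t, ht, rfl⟩ := exists_eq_exp_neg_pi_mul hq₂
  refine (isPreconnected_Ioo.intermediate_value hq₁ (exp_neg_pi_div_mem_Ioo ht)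
    continuousOn_ellipticParameter) ⟨h₁.le, ?_⟩
  rw [ellipticParameter_exp_neg_pi_div ht]
  linarith

/-- The reciprocal of `∏ i ∈ range m, (1 - w ^ (i + 1))`, extended by zero to negative `m`. -/
noncomputable def invPochhammer (w : ℝ) (m : ℤ) : ℝ :=
  if m < 0 then 0 else (∏ i ∈ Finset.range m.toNat, (1 - w ^ (i + 1)))⁻¹

theorem invPochhammer_of_neg {w : ℝ} {m : ℤ} (hm : m < 0) : invPochhammer w m = 0 := if_pos hm

theorem invPochhammer_natCast (w : ℝ) (n : ℕ) :
    invPochhammer w n = (∏ i ∈ Finset.range n, (1 - w ^ (i + 1)))⁻¹ := by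
  simp [invPochhammer]

theorem tendsto_prod_one_add {u : ℕ → ℝ} (hu : Summable u) (hpos : ∀ i, 0 < 1 + u i) :
    Filter.Tendsto (fun n => ∏ i ∈ Finset.range n, (1 + u i)) Filter.atTop
      (nhds (Real.exp (∑' i, Real.log (1 + u i)))) := by
  have h := (Real.summable_log_one_add_of_summable hu).hasSum.tendsto_sum_nat.rexp
  refine h.congr fun n => ?_
  rw [Real.exp_sum]
  exact Finset.prod_congr rfl fun i _ => Real.exp_log (hpos i)

section InvPochhammer

variable {w : ℝ} (hw : w ∈ Set.Ioo (0 : ℝ) 1)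
include hw

theorem one_sub_zpow_mul_invPochhammer (m : ℤ) :
    (1 - w ^ m) * invPochhammer w m = invPochhammer w (m - 1) := by
  rcases lt_trichotomy m 0 with hm | rfl | hm
  · rw [invPochhammer_of_neg hm, invPochhammer_of_neg (by omega), mul_zero]
  · rw [zpow_zero, sub_self, zero_mul, invPochhammer_of_neg (by omega)]
  · obtain ⟨n, rfl⟩ : ∃ n : ℕ, m = (n + 1 : ℕ) := ⟨m.toNat - 1, by omega⟩
    have h : 0 < 1 - w ^ (n + 1) := sub_pos.2 (pow_lt_one₀ hw.1.le hw.2 n.succ_ne_zero)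
    rw [show ((n + 1 : ℕ) : ℤ) - 1 = (n : ℕ) by push_cast; ring, invPochhammer_natCast,
      invPochhammer_natCast, Finset.prod_range_succ, mul_inv, zpow_natCast]
    field_simp

theorem exists_tendsto_invPochhammer :
    ∃ E, 0 < E ∧ Filter.Tendsto (invPochhammer w) Filter.atTop (nhds E) := by
  have hsum : Summable fun i : ℕ => -w ^ (i + 1) :=
    ((summable_geometric_of_lt_one hw.1.le hw.2).comp_injective (add_left_injective 1)).neg
  have hpos (i : ℕ) : 0 < 1 + -w ^ (i + 1) := by
    rw [← sub_eq_add_neg, sub_pos]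
    exact pow_lt_one₀ hw.1.le hw.2 i.succ_ne_zero
  have h := tendsto_prod_one_add hsum hpos
  have htoNat : Filter.Tendsto Int.toNat Filter.atTop Filter.atTop :=
    Filter.tendsto_atTop.2 fun n => (Filter.eventually_ge_atTop (n : ℤ)).mono fun m hm => by omega
  refine ⟨(Real.exp (∑' i : ℕ, Real.log (1 + -w ^ (i + 1))))⁻¹, inv_pos.2 (Real.exp_pos _), ?_⟩
  refine ((h.inv₀ (Real.exp_pos _).ne').comp htoNat).congr' ?_
  filter_upwards [Filter.eventually_ge_atTop 0] with m hm
  simp only [Function.comp_apply, invPochhammer, if_neg hm.not_gt, sub_eq_add_neg]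

theorem exists_norm_invPochhammer_le : ∃ M, ∀ m, ‖invPochhammer w m‖ ≤ M := by
  obtain ⟨E, -, hE⟩ := exists_tendsto_invPochhammer hw
  obtain ⟨M, hM⟩ := (Metric.isBounded_range_of_tendsto _
    (hE.comp tendsto_natCast_atTop_atTop)).exists_norm_le
  refine ⟨max M 0, fun m => ?_⟩
  rcases lt_or_ge m 0 with hm | hm
  · simp [invPochhammer_of_neg hm]
  · lift m to ℕ using hm
    exact (hM _ ⟨m, rfl⟩).trans (le_max_left _ _)

end InvPochhammer

section TripleProduct

variable {q : ℝ} (hq : q ∈ Set.Ioo (0 : ℝ) 1)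
include hq

/-- The recurrence between consecutive finite forms of the Jacobi triple product. -/
theorem triple_product_coeff_succ {z : ℝ} (hz : z ≠ 0) (n j : ℤ) :
    (1 - (q ^ 2) ^ (2 * n + 1)) * (1 - (q ^ 2) ^ (2 * n + 2)) *
        (invPochhammer (q ^ 2) (n + 1 - j) * invPochhammer (q ^ 2) (n + 1 + j) *
          (z ^ j * q ^ (j ^ 2))) =
      (1 + (q ^ 2) ^ (2 * n + 1)) *
          (invPochhammer (q ^ 2) (n - j) * invPochhammer (q ^ 2) (n + j) * (z ^ j * q ^ (j ^ 2))) +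
        z * q ^ (2 * n + 1) * (invPochhammer (q ^ 2) (n - (j - 1)) *
          invPochhammer (q ^ 2) (n + (j - 1)) * (z ^ (j - 1) * q ^ ((j - 1) ^ 2))) +
        z⁻¹ * q ^ (2 * n + 1) * (invPochhammer (q ^ 2) (n - (j + 1)) *
          invPochhammer (q ^ 2) (n + (j + 1)) * (z ^ (j + 1) * q ^ ((j + 1) ^ 2))) := by
  have hq₀ := hq.1.ne'
  have hw := sq_mem_Ioo hq
  have hrec := one_sub_zpow_mul_invPochhammer hw
  have hα := hrec (n + 1 - j)
  have hα' := hrec (n - j)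
  have hβ := hrec (n + 1 + j)
  have hβ' := hrec (n + j)
  rw [show n + 1 - j - 1 = n - j by ring] at hα
  rw [show n - j - 1 = n - (j + 1) by ring, ← hα] at hα'
  rw [show n + 1 + j - 1 = n + j by ring] at hβ
  rw [show n + j - 1 = n + (j - 1) by ring, ← hβ] at hβ'
  rw [← hα', ← hβ', ← hα, ← hβ, show n - (j - 1) = n + 1 - j by ring,
    show n + (j + 1) = n + 1 + j by ring]
  have e₁ : q ^ ((j - 1) ^ 2) = q ^ (j ^ 2) * (q ^ j)⁻¹ ^ 2 * q := by
    rw [← zpow_neg, ← zpow_natCast, ← zpow_mul, ← zpow_add₀ hq₀, ← zpow_add_one₀ hq₀]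
    congr 1; push_cast; ring
  have e₂ : q ^ ((j + 1) ^ 2) = q ^ (j ^ 2) * (q ^ j) ^ 2 * q := by
    rw [← zpow_natCast (q ^ j), ← zpow_mul, ← zpow_add₀ hq₀, ← zpow_add_one₀ hq₀]
    congr 1; push_cast; ring
  have hw₀ := hw.1.ne'
  simp only [zpow_add₀ hw₀, zpow_sub₀ hw₀, zpow_add₀ hq₀, zpow_mul' _ (2 : ℤ), zpow_add₀ hz,
    zpow_sub₀ hz, e₁, e₂, zpow_one]
  have hQ : (q ^ 2) ^ n = (q ^ n) ^ 2 := by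
    rw [← zpow_natCast, ← zpow_natCast, zpow_comm]
  have hJ : (q ^ 2) ^ j = (q ^ j) ^ 2 := by
    rw [← zpow_natCast, ← zpow_natCast, zpow_comm]
  norm_cast
  simp only [hQ, hJ]
  have := zpow_ne_zero n hq₀
  have := zpow_ne_zero j hq₀
  generalize q ^ (j ^ 2) = A
  generalize q ^ n = B at *
  generalize q ^ j = C at *
  generalize z ^ j = D
  generalize invPochhammer (q ^ 2) (n + 1 - j) = α
  generalize invPochhammer (q ^ 2) (n + 1 + j) = β
  field_simp
  ring

/-- The finite form of the Jacobi triple product. -/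
theorem hasSum_finite_triple_product {z : ℝ} (hz : z ≠ 0) (n : ℕ) :
    HasSum (fun j : ℤ => invPochhammer (q ^ 2) (n - j) * invPochhammer (q ^ 2) (n + j) *
        (z ^ j * q ^ (j ^ 2)))
      ((∏ i ∈ Finset.range n, ((1 + z * q ^ (2 * i + 1)) * (1 + z⁻¹ * q ^ (2 * i + 1)))) *
        invPochhammer (q ^ 2) (2 * n)) := by
  have hw := sq_mem_Ioo hq
  induction n with
  | zero =>
    have h0 : invPochhammer (q ^ 2) 0 = 1 := by simpa using invPochhammer_natCast (q ^ 2) 0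
    convert hasSum_single (f := fun j : ℤ => invPochhammer (q ^ 2) ((0 : ℕ) - j) *
      invPochhammer (q ^ 2) ((0 : ℕ) + j) * (z ^ j * q ^ (j ^ 2))) 0 fun j hj => ?_ using 1
    · simp [h0]
    · rcases lt_or_gt_of_ne hj with hj | hj
      · rw [invPochhammer_of_neg (m := (0 : ℕ) + j) (by simpa), mul_zero, zero_mul]
      · rw [invPochhammer_of_neg (m := (0 : ℕ) - j) (by simpa), zero_mul, zero_mul]
  | succ n ih =>
    have hd₁ : 1 - (q ^ 2) ^ (2 * n + 1) ≠ 0 :=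
      (sub_pos.2 (pow_lt_one₀ hw.1.le hw.2 (by omega))).ne'
    have hd₂ : 1 - (q ^ 2) ^ (2 * n + 2) ≠ 0 :=
      (sub_pos.2 (pow_lt_one₀ hw.1.le hw.2 (by omega))).ne'
    have hl := ((Equiv.subRight (1 : ℤ)).hasSum_iff.2 ih).mul_left (z * q ^ (2 * n + 1))
    have hr := ((Equiv.addRight (1 : ℤ)).hasSum_iff.2 ih).mul_left (z⁻¹ * q ^ (2 * n + 1))
    have h := ((ih.mul_left (1 + (q ^ 2) ^ (2 * n + 1))).add hl).add hr
    have e₁ := one_sub_zpow_mul_invPochhammer hw (2 * n + 2)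
    have e₂ := one_sub_zpow_mul_invPochhammer hw (2 * n + 1)
    rw [show (2 * n + 2 - 1 : ℤ) = 2 * n + 1 by ring] at e₁
    rw [show (2 * n + 1 - 1 : ℤ) = 2 * n by ring, ← e₁] at e₂
    rw [← hasSum_mul_left_iff (mul_ne_zero hd₁ hd₂)]
    convert! h using 1
    · funext j
      have := triple_product_coeff_succ hq hz n j
      simp only [Function.comp_apply, Equiv.subRight_apply, Equiv.coe_addRight]
      push_cast
      norm_cast at this ⊢
    · rw [← e₂, Finset.prod_range_succ, show (2 * (n + 1 : ℕ) : ℤ) = 2 * n + 2 by push_cast; ring]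
      norm_cast
      field_simp
      ring

/-- The Jacobi triple product, up to a factor independent of `z`. -/
theorem exists_tendsto_triple_product :
    ∃ E, 0 < E ∧ ∀ z : ℝ, z ≠ 0 → (Summable fun j : ℤ => z ^ j * q ^ (j ^ 2)) →
      Filter.Tendsto (fun n => ∏ i ∈ Finset.range n,
          ((1 + z * q ^ (2 * i + 1)) * (1 + z⁻¹ * q ^ (2 * i + 1)))) Filter.atTop
        (nhds (E * ∑' j : ℤ, z ^ j * q ^ (j ^ 2))) := by
  have hw := sq_mem_Ioo hq
  obtain ⟨E, hE₀, hE⟩ := exists_tendsto_invPochhammer hw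
  obtain ⟨M, hM⟩ := exists_norm_invPochhammer_le hw
  refine ⟨E, hE₀, fun z hz hs => ?_⟩
  have hcast : Filter.Tendsto (fun n : ℕ => (n : ℤ)) Filter.atTop Filter.atTop :=
    tendsto_natCast_atTop_atTop
  have hlim : Filter.Tendsto (fun n : ℕ => ∑' j : ℤ, invPochhammer (q ^ 2) (n - j) *
      invPochhammer (q ^ 2) (n + j) * (z ^ j * q ^ (j ^ 2))) Filter.atTop
      (nhds (∑' j : ℤ, E * E * (z ^ j * q ^ (j ^ 2)))) := by
    refine tendsto_tsum_of_dominated_convergence (hs.norm.mul_left (M * M)) (fun j => ?_)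
      (.of_forall fun n j => ?_)
    · refine Filter.Tendsto.mul_const _ (Filter.Tendsto.mul ?_ ?_)
      · exact hE.comp (Filter.tendsto_atTop_add_const_right _ (-j) hcast)
      · exact hE.comp (Filter.tendsto_atTop_add_const_right _ j hcast)
    · rw [norm_mul, norm_mul]
      gcongr
      · exact (norm_nonneg _).trans (hM 0)
      · exact hM _
      · exact hM _
  simp only [(hasSum_finite_triple_product hq hz _).tsum_eq] at hlim
  rw [tsum_mul_left] at hlim
  have h2 : Filter.Tendsto (fun n : ℕ => invPochhammer (q ^ 2) (2 * n)) Filter.atTop (nhds E) :=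
    hE.comp (hcast.const_mul_atTop' two_pos)
  have h := hlim.div h2 hE₀.ne'
  rw [show E * E * (∑' j : ℤ, z ^ j * q ^ (j ^ 2)) / E = E * ∑' j : ℤ, z ^ j * q ^ (j ^ 2) by
    field_simp] at h
  refine h.congr fun n => mul_div_cancel_right₀ _ ?_
  have hcoe : (2 * n : ℤ) = (2 * n : ℕ) := by push_cast; rfl
  rw [hcoe, invPochhammer_natCast]
  exact inv_ne_zero (Finset.prod_ne_zero_iff.2 fun i _ =>
    (sub_pos.2 (pow_lt_one₀ hw.1.le hw.2 i.succ_ne_zero)).ne')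

theorem summable_neg_one_pow_mul_log_one_add_pow :
    Summable fun k : ℕ => (-1) ^ (k + 1) * Real.log (1 + q ^ (k + 1)) := by
  have hs : Summable fun k : ℕ => q ^ (k + 1) :=
    (summable_geometric_of_lt_one hq.1.le hq.2).comp_injective (add_left_injective 1)
  refine .of_norm ?_
  simpa using (Real.summable_log_one_add_of_summable hs).norm

theorem shiftedThetaSeries_div_thetaSeries :
    shiftedThetaSeries q / thetaSeries q =
      2 * Real.exp (∑' k : ℕ, (-1) ^ (k + 1) * Real.log (1 + q ^ (k + 1))) ^ 2 := by
  have hgeom := summable_geometric_of_lt_one hq.1.le hq.2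
  have hq' := hq.1
  have hθ := summable_zpow_sq hq.1 hq.2
  have hψ := summable_zpow_sq_add_self hq.1 hq.2
  obtain ⟨E, hE₀, hE⟩ := exists_tendsto_triple_product hq
  have hodd : Summable fun i : ℕ => q ^ (2 * i + 1) :=
    hgeom.comp_injective fun a b h => by simpa using h
  have heven : Summable fun i : ℕ => q ^ (2 * i + 2) :=
    hgeom.comp_injective fun a b h => by simpa using h
  have ho := tendsto_prod_one_add hodd fun i => by positivity
  have he := tendsto_prod_one_add heven fun i => by positivity
  set So := ∑' i : ℕ, Real.log (1 + q ^ (2 * i + 1))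
  set Se := ∑' i : ℕ, Real.log (1 + q ^ (2 * i + 2))
  have hm₁ (k : ℕ) : (-1 : ℝ) ^ (2 * k + 1) = -1 := by simp [pow_succ, pow_mul]
  have hm₂ (k : ℕ) : (-1 : ℝ) ^ (2 * k + 1 + 1) = 1 := by simp [pow_succ, pow_mul]
  have hsum : ∑' k : ℕ, (-1) ^ (k + 1) * Real.log (1 + q ^ (k + 1)) = Se - So := by
    rw [← tsum_even_add_odd (f := fun k : ℕ => (-1) ^ (k + 1) * Real.log (1 + q ^ (k + 1)))]
    · simp only [hm₁, hm₂, neg_mul, one_mul, tsum_neg]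
      exact neg_add_eq_sub So Se
    · simpa only [hm₁, neg_mul, one_mul] using (Real.summable_log_one_add_of_summable hodd).neg
    · simpa only [hm₂, one_mul] using! Real.summable_log_one_add_of_summable heven
  have h1 : E * thetaSeries q = Real.exp So ^ 2 := by
    have h := hE 1 one_ne_zero (by simpa using hθ)
    simp only [one_zpow, inv_one, one_mul, ← sq, Finset.prod_pow] at h
    exact tendsto_nhds_unique h (ho.pow 2)
  have h2 : E * shiftedThetaSeries q = 2 * Real.exp Se ^ 2 := by
    have hz (j : ℤ) : q ^ j * q ^ (j ^ 2) = q ^ (j ^ 2 + j) := by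
      rw [← zpow_add₀ hq'.ne', add_comm]
    have h := hE q hq'.ne' (by simpa only [hz] using hψ)
    simp only [hz] at h
    have hpow : Filter.Tendsto (fun n : ℕ => 1 + q ^ (2 * n)) Filter.atTop (nhds 1) := by
      simpa [pow_mul] using (tendsto_pow_atTop_nhds_zero_of_lt_one (sq_nonneg q)
        (sq_mem_Ioo hq).2).const_add 1
    have h' := h.mul hpow
    rw [mul_one] at h'
    refine tendsto_nhds_unique h' (((he.pow 2).const_mul 2).congr fun n => ?_)
    induction n with
    | zero => norm_num
    | succ n ih =>
      rw [Finset.prod_range_succ, Finset.prod_range_succ, mul_pow, ← mul_assoc, ih,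
        show q⁻¹ * q ^ (2 * n + 1) = q ^ (2 * n) by field_simp; ring]
      ring
  have ha := thetaSeries_pos hq.1 hq.2
  rw [hsum, Real.exp_sub]
  have := Real.exp_pos So
  rw [div_eq_iff ha.ne', ← mul_right_inj' hE₀.ne', h2, mul_left_comm, h1]
  field_simp

theorem log_ellipticParameter :
    Real.log (ellipticParameter q) = 4 * Real.log 2 + (Real.log q +
      8 * ∑' k : ℕ, (-1) ^ (k + 1) * Real.log (1 + q ^ (k + 1))) := by
  have hq' := hq.1
  rw [ellipticParameter, mul_div_assoc, ← div_pow, shiftedThetaSeries_div_thetaSeries hq,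
    Real.log_mul hq'.ne' (by positivity), Real.log_pow, Real.log_mul two_ne_zero (by positivity),
    Real.log_pow, Real.log_exp]
  push_cast
  ring

end TripleProduct

theorem hasDerivAt_tsum_log_one_add_pow {q : ℝ} (hq : q ∈ Set.Ioo (0 : ℝ) 1) :
    HasDerivAt (fun q : ℝ => ∑' k : ℕ, (-1) ^ (k + 1) * Real.log (1 + q ^ (k + 1)))
      (∑' k : ℕ, (-1) ^ (k + 1) * (((k : ℝ) + 1) * q ^ k / (1 + q ^ (k + 1)))) q := by
  obtain ⟨ρ, hqρ, hρ⟩ := exists_between hq.2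
  have hρ₀ := hq.1.trans hqρ
  have hu : Summable fun k : ℕ => ((k : ℝ) + 1) * ρ ^ k := by
    have hρ' : ‖ρ‖ < 1 := by rwa [Real.norm_of_nonneg hρ₀.le]
    simpa [add_mul] using (hasSum_coe_mul_geometric_of_norm_lt_one hρ').summable.add
      (summable_geometric_of_lt_one hρ₀.le hρ)
  refine hasDerivAt_tsum_of_isPreconnected (t := Set.Ioo 0 ρ) (y₀ := q)
    (g := fun (k : ℕ) (y : ℝ) => (-1) ^ (k + 1) * Real.log (1 + y ^ (k + 1)))
    (g' := fun (k : ℕ) (y : ℝ) => (-1) ^ (k + 1) * (((k : ℝ) + 1) * y ^ k / (1 + y ^ (k + 1)))) hu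
    isOpen_Ioo isPreconnected_Ioo (fun k y hy => ?_) (fun k y hy => ?_) ⟨hq.1, hqρ⟩
    (summable_neg_one_pow_mul_log_one_add_pow hq) ⟨hq.1, hqρ⟩
  · have hy₀ := hy.1
    have h := ((hasDerivAt_pow (k + 1) y).const_add 1).log (by positivity)
    simpa using h.const_mul ((-1) ^ (k + 1))
  · have hy₀ := hy.1
    rw [norm_mul, norm_pow, norm_neg, norm_one, one_pow, one_mul,
      Real.norm_of_nonneg (by positivity)]
    calc
      _ ≤ ((k : ℝ) + 1) * y ^ k := div_le_self (by positivity) (by linarith [pow_pos hy₀ (k + 1)])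
      _ ≤ _ := by gcongr; exact hy.2.le

theorem hasDerivAt_log_ellipticParameter {q : ℝ} (hq : q ∈ Set.Ioo (0 : ℝ) 1) :
    HasDerivAt (fun q => Real.log (ellipticParameter q)) (Γ' q / q) q := by
  have h := (((Real.hasDerivAt_log hq.1.ne').add
    ((hasDerivAt_tsum_log_one_add_pow hq).const_mul 8)).const_add (4 * Real.log 2))
  refine (h.congr_of_eventuallyEq ?_).congr_deriv ?_
  · filter_upwards [Ioo_mem_nhds hq.1 hq.2] with y hy using log_ellipticParameter hy
  · rw [Γ', add_div, one_div, mul_div_assoc, ← tsum_div_const]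
    have := hq.1
    congr! 4 with k
    field_simp
    ring

theorem Γ'_sq {q : ℝ} (hq : q ∈ Set.Ioo (0 : ℝ) 1) :
    Γ' (q ^ 2) * altThetaSeries q ^ 2 = Γ' q * thetaSeries q ^ 2 := by
  have hk := landenModulus_mem_Ioo hq
  have hlog {y : ℝ} (hy : y ∈ Set.Ioo (0 : ℝ) 1) :
      Real.exp (1 / 2 * Real.log (ellipticParameter (y ^ 2))) = landenModulus y := by
    rw [ellipticParameter_sq, Real.log_pow, Nat.cast_ofNat, one_div,
      inv_mul_cancel_left₀ two_ne_zero, Real.exp_log (landenModulus_mem_Ioo hy).1]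
  have hsq : HasDerivAt (fun y : ℝ => 1 / 2 * Real.log (ellipticParameter (y ^ 2)))
      (Γ' (q ^ 2) / q) q := by
    have h := (HasDerivAt.comp (h := fun y : ℝ => y ^ 2) q
      (hasDerivAt_log_ellipticParameter (sq_mem_Ioo hq)) (hasDerivAt_pow 2 q)).const_mul (1 / 2)
    refine h.congr_deriv ?_
    have := hq.1
    field_simp
    push_cast
    ring
  have hright := (hsq.const_add (Real.log 4)).sub
    (((hsq.exp.const_add 1).log (by positivity)).const_mul 2)
  have hleft := hasDerivAt_log_ellipticParameter hq
  have heq := hleft.unique (hright.congr_of_eventuallyEq ?_)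
  · rw [hlog hq] at heq
    have ha := thetaSeries_pos hq.1 hq.2
    have ha' := thetaSeries_pos (sq_mem_Ioo hq).1 (sq_mem_Ioo hq).2
    have h0 := hq.1
    have h1 : 0 < 1 + landenModulus q := by linarith [hk.1]
    have hr : Γ' q * (1 + landenModulus q) = Γ' (q ^ 2) * (1 - landenModulus q) := by
      field_simp at heq
      linear_combination heq
    rw [one_add_landenModulus hq, one_sub_landenModulus hq] at hr
    field_simp at hr
    linear_combination -hr
  · filter_upwards [Ioo_mem_nhds hq.1 hq.2] with y hy
    have hy' := (landenModulus_mem_Ioo hy).1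
    simp only [Pi.sub_apply, hlog hy]
    rw [ellipticParameter_eq_landen hy, Real.log_div (by positivity) (by positivity),
      Real.log_mul (by positivity) hy'.ne', Real.log_pow, ellipticParameter_sq, Real.log_pow]
    push_cast
    ring

theorem tendsto_Γ' : Filter.Tendsto Γ' (nhdsWithin 0 (Set.Ioi 0)) (nhds 1) := by
  have hb : Filter.Tendsto (fun q : ℝ => 8 * (q / (1 - q) ^ 2)) (nhdsWithin 0 (Set.Ioi 0))
      (nhds 0) := by
    have : ContinuousAt (fun q : ℝ => 8 * (q / (1 - q) ^ 2)) 0 :=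
      continuousAt_const.mul (ContinuousAt.div (by fun_prop) (by fun_prop) (by simp))
    simpa using this.tendsto.mono_left nhdsWithin_le_nhds
  rw [tendsto_iff_norm_sub_tendsto_zero]
  refine squeeze_zero' (.of_forall fun _ => norm_nonneg _)
    (eventually_mem_Ioo_nhdsGT_zero.mono fun q hq => ?_) hb
  have hq₀ := hq.1
  have hs := hasSum_coe_mul_geometric_of_norm_lt_one (r := q)
    (by rw [Real.norm_of_nonneg hq₀.le]; exact hq.2)
  have hs' : HasSum (fun k : ℕ => ((k : ℝ) + 1) * q ^ (k + 1)) (q / (1 - q) ^ 2) := by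
    rw [← hasSum_nat_add_iff' 1] at hs
    simpa using hs
  rw [Γ', add_sub_cancel_left, norm_mul, Real.norm_ofNat]
  gcongr
  refine tsum_of_norm_bounded hs' fun k => ?_
  rw [mul_assoc, mul_div_assoc, norm_mul, norm_pow, norm_neg, norm_one, one_pow, one_mul,
    Real.norm_of_nonneg (by positivity)]
  exact div_le_self (by positivity) (by linarith [pow_pos hq₀ (k + 1)])

/-- Jacobi's four-square identity with alternating signs. -/
theorem Γ'_eq_altThetaSeries_pow_four {q : ℝ} (hq : q ∈ Set.Ioo (0 : ℝ) 1) :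
    Γ' q = altThetaSeries q ^ 4 := by
  have hlim : Filter.Tendsto (fun q => Γ' q / altThetaSeries q ^ 4)
      (nhdsWithin 0 (Set.Ioi 0)) (nhds 1) := by
    simpa using! tendsto_Γ'.div (tendsto_altThetaSeries.pow 4) (by simp)
  have h := eq_of_tendsto_of_forall_sq (fun y hy => ?_) hlim hq
  · rwa [div_eq_one_iff_eq (pow_ne_zero 4 (altThetaSeries_ne_zero hq))] at h
  · have hb := altThetaSeries_ne_zero hy
    have ha := thetaSeries_pos hy.1 hy.2
    rw [show altThetaSeries (y ^ 2) ^ 4 = (altThetaSeries (y ^ 2) ^ 2) ^ 2 by ring,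
      ← thetaSeries_mul_altThetaSeries hy.1 hy.2]
    field_simp
    linear_combination Γ'_sq hy

theorem gamma_elliptic :
    (∀ x ∈ Set.Ioo (0 : ℝ) 1, Γ' (H x) = K x ^ 2 * (1 - x)) ∧
    ∀ ν ∈ Set.Ioo (0 : ℝ) 1, 0 < Γ' ν := by
  refine ⟨fun x hx => ?_, fun ν hν => ?_⟩
  · obtain ⟨q, hq, rfl⟩ := surjOn_ellipticParameter hx
    have ha := thetaSeries_pos hq.1 hq.2
    rw [H_ellipticParameter hq, K_ellipticParameter hq, one_sub_ellipticParameter hq.1 hq.2,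
      Γ'_eq_altThetaSeries_pow_four hq]
    field_simp
  · rw [Γ'_eq_altThetaSeries_pow_four hν]
    have := altThetaSeries_ne_zero hν
    positivity
end

section
/- Let Γ(ν) = 1 + 8 Σ_{k=1}^{∞} (-1)^k k ν^k/(1+ν^k). Then Γ(ν) ~ (4π/log(1/ν))² exp(-π²/log(1/ν)) as ν → 1⁻, i.e. the ratio of the two sides tends to 1. -/
open Filter Topology

/-- The Lambert series `∑ k xᵏ / (1 - xᵏ)`. -/
noncomputable def lambertSigma (x : ℝ) : ℝ := ∑' k : ℕ, (k : ℝ) * x ^ k / (1 - x ^ k)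

lemma summable_lambertSigma {x : ℝ} (h0 : 0 ≤ x) (h1 : x < 1) :
    Summable fun k : ℕ => (k : ℝ) * x ^ k / (1 - x ^ k) := by
  simpa using summable_norm_pow_mul_geometric_div_one_sub 1 (r := x)
    (by rwa [Real.norm_of_nonneg h0])

lemma hasSum_alternating_lambertSigma {x : ℝ} (h0 : 0 ≤ x) (h1 : x < 1) :
    HasSum (fun k : ℕ => (-1) ^ k * ((k : ℝ) * x ^ k / (1 - x ^ k)))
      (4 * lambertSigma (x ^ 2) - lambertSigma x) := by
  have hx2 : x ^ 2 < 1 := pow_lt_one₀ h0 h1 two_ne_zero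
  have h : HasSum _ (lambertSigma x) := (summable_lambertSigma h0 h1).hasSum
  have h2 : HasSum _ (lambertSigma (x ^ 2)) :=
    (summable_lambertSigma (sq_nonneg x) hx2).hasSum
  have he : HasSum (fun k : ℕ => ((1 : ℝ) + (-1) ^ k) * ((k : ℝ) * x ^ k / (1 - x ^ k)))
      (4 * lambertSigma (x ^ 2) + 0) := by
    refine HasSum.even_add_odd ?_ ?_
    · convert! h2.mul_left 4 using 1
      funext k
      simp only [pow_mul, Nat.cast_mul, Nat.cast_ofNat]
      norm_num
      ring
    · simp [pow_add, pow_mul, hasSum_zero]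
  rw [add_zero] at he
  convert! he.sub h using 1
  funext k
  ring

lemma gamma_eq_lambertSigma {x : ℝ} (h0 : 0 < x) (h1 : x < 1) :
    Γ' x = 1 + 8 * (-lambertSigma x + 6 * lambertSigma (x ^ 2) - 8 * lambertSigma (x ^ 4)) := by
  have hx2 : x ^ 2 < 1 := pow_lt_one₀ h0.le h1 two_ne_zero
  have h := (hasSum_alternating_lambertSigma h0.le h1).sub
    ((hasSum_alternating_lambertSigma (sq_nonneg x) hx2).mul_left 2)
  have h' := (hasSum_nat_add_iff' 1).mpr h
  rw [Γ']
  congr 2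
  convert h'.tsum_eq using 1
  · refine tsum_congr fun k => ?_
    have hk : x ^ (k + 1) < 1 := pow_lt_one₀ h0.le h1 (by simp)
    have hp : 0 < x ^ (k + 1) := by positivity
    have e : (x ^ 2) ^ (k + 1) = (x ^ (k + 1)) ^ 2 := by rw [← pow_mul, ← pow_mul, mul_comm]
    rw [e]
    generalize x ^ (k + 1) = t at *
    have : 1 - t ≠ 0 := by linarith
    have : 1 + t ≠ 0 := by linarith
    have : 1 - t ^ 2 ≠ 0 := by nlinarith
    push_cast
    field_simp
    ring
  · simp
    rw [← pow_mul]
    ring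

lemma tendsto_lambertSigma_div : Tendsto (fun x => lambertSigma x / x) (𝓝[>] 0) (𝓝 1) := by
  have key : Tendsto (fun x : ℝ => ∑' k : ℕ, ((k : ℝ) + 1) * x ^ k / (1 - x ^ (k + 1)))
      (𝓝[>] 0) (𝓝 (∑' k : ℕ, ((k : ℝ) + 1) * (0 : ℝ) ^ k / (1 - 0 ^ (k + 1)))) := by
    refine tendsto_tsum_of_dominated_convergence
      (bound := fun k : ℕ => ((k : ℝ) + 1) * (1 / 2) ^ k * 2) ?_ (fun k => ?_) ?_
    · refine Summable.mul_right _ ?_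
      have h1 := summable_pow_mul_geometric_of_norm_lt_one 1 (r := (1 / 2 : ℝ)) (by norm_num)
      have h2 := summable_geometric_two
      simpa [add_mul] using h1.add h2
    · have : ContinuousAt (fun x : ℝ => ((k : ℝ) + 1) * x ^ k / (1 - x ^ (k + 1))) 0 := by
        refine ContinuousAt.div (by fun_prop) (by fun_prop) (by simp)
      exact this.tendsto.mono_left nhdsWithin_le_nhds
    · filter_upwards [Ioo_mem_nhdsGT (show (0 : ℝ) < 1 / 2 by norm_num)] with x hx k
      obtain ⟨hx0, hx1⟩ := hx
      have : x ^ (k + 1) ≤ x := pow_le_of_le_one hx0.le (by linarith) (by simp)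
      have h3 : (1 - x ^ (k + 1))⁻¹ ≤ 2 := by
        rw [inv_le_comm₀ (by linarith) (by norm_num)]
        linarith
      have h4 : 0 ≤ (1 - x ^ (k + 1))⁻¹ := inv_nonneg.mpr (by linarith)
      rw [div_eq_mul_inv, Real.norm_of_nonneg (by positivity)]
      gcongr
  have h0 : (∑' k : ℕ, ((k : ℝ) + 1) * (0 : ℝ) ^ k / (1 - 0 ^ (k + 1))) = 1 := by
    rw [tsum_eq_single 0 (by simp +contextual)]
    simp
  rw [h0] at key
  refine key.congr' ?_
  filter_upwards [Ioo_mem_nhdsGT (show (0 : ℝ) < 1 by norm_num)] with x hx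
  rw [lambertSigma, (summable_lambertSigma hx.1.le hx.2).tsum_eq_zero_add]
  simp only [CharP.cast_eq_zero, zero_mul, zero_div, zero_add]
  rw [← tsum_div_const]
  refine tsum_congr fun k => ?_
  have := hx.1.ne'
  push_cast
  rw [pow_succ]
  field_simp

open UpperHalfPlane EisensteinSeries in
lemma E2_mul_I_eq_lambertSigma (z : ℍ) {y : ℝ} (hy : 0 < y) (hz : (z : ℂ) = y * Complex.I) :
    E2 z = ((1 - 24 * lambertSigma (Real.exp (-2 * Real.pi * y)) : ℝ) : ℂ) := by
  obtain ⟨x, hx⟩ : ∃ x, x = Real.exp (-2 * Real.pi * y) := ⟨_, rfl⟩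
  have hx0 : 0 < x := hx ▸ Real.exp_pos _
  have hx1 : x < 1 := hx ▸ Real.exp_lt_one_iff.mpr (by nlinarith [Real.pi_pos])
  have hq : Complex.exp (2 * Real.pi * Complex.I * z) = (x : ℂ) := by
    rw [hz, hx, Complex.ofReal_exp]
    congr 1
    push_cast
    linear_combination (2 * Real.pi * y : ℂ) * Complex.I_mul_I
  have hn : ‖(x : ℂ)‖ < 1 := by
    rwa [Complex.norm_real, Real.norm_of_nonneg hx0.le]
  rw [← hx, E2_eq_tsum_cexp, hq, ← tsum_pow_div_one_sub_eq_tsum_sigma hn 1,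
    tsum_pnat_eq_tsum_succ (f := fun n => (n : ℂ) ^ 1 * (x : ℂ) ^ n / (1 - (x : ℂ) ^ n)),
    lambertSigma, (summable_lambertSigma hx0.le hx1).tsum_eq_zero_add]
  push_cast
  simp

open UpperHalfPlane EisensteinSeries in
lemma lambertSigma_functional_equation {y : ℝ} (hy : 0 < y) :
    1 - 24 * lambertSigma (Real.exp (-2 * Real.pi * y)) =
      -(1 - 24 * lambertSigma (Real.exp (-2 * Real.pi * (1 / y)))) / y ^ 2
        + 6 / (Real.pi * y) := by
  have hpi : (Real.pi : ℂ) ≠ 0 := by exact_mod_cast Real.pi_ne_zero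
  have hy' : (y : ℂ) ≠ 0 := by exact_mod_cast hy.ne'
  let z : ℍ := ⟨y * Complex.I, by simpa using hy⟩
  have hz : (z : ℂ) = y * Complex.I := rfl
  have hw : ((ModularGroup.S • z : ℍ) : ℂ) = ((1 / y : ℝ) : ℂ) * Complex.I := by
    rw [modular_S_smul]
    simp [hz, mul_comm]
  have h := congrFun (E2_slash_action ModularGroup.S) z
  rw [SlashInvariantForm.slash_S_apply, ← modular_S_smul] at h
  simp only [Pi.sub_apply, Pi.smul_apply, D2_S, riemannZeta_two, smul_eq_mul] at h
  rw [E2_mul_I_eq_lambertSigma z hy hz,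
    E2_mul_I_eq_lambertSigma _ (one_div_pos.mpr hy) hw, hz] at h
  have hI := Complex.I_sq
  rw [← Complex.ofReal_inj]
  push_cast at h ⊢
  field_simp at h ⊢
  linear_combination h + (y * (y * (1 - 24 * ↑(lambertSigma (Real.exp (-(2 * Real.pi * y))))) *
    ↑Real.pi - 6) : ℂ) * hI


lemma gamma_exp_eq {L : ℝ} (hL : 0 < L) {p : ℝ} (hp : p = Real.exp (-Real.pi ^ 2 / L)) :
    Γ' (Real.exp (-L)) = 16 * (Real.pi / L) ^ 2 *
      (lambertSigma p - 3 * lambertSigma (p ^ 2) + 2 * lambertSigma (p ^ 4)) := by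
  have hpi := Real.pi_pos
  have f1 := lambertSigma_functional_equation (y := L / (2 * Real.pi)) (by positivity)
  have f2 := lambertSigma_functional_equation (y := L / Real.pi) (by positivity)
  have f4 := lambertSigma_functional_equation (y := 2 * L / Real.pi) (by positivity)
  rw [show -2 * Real.pi * (L / (2 * Real.pi)) = -L by field_simp,
    show Real.exp (-2 * Real.pi * (1 / (L / (2 * Real.pi)))) = p ^ 4 by
      rw [hp, ← Real.exp_nat_mul]; congr 1; push_cast; field_simp; ring] at f1
  rw [show Real.exp (-2 * Real.pi * (L / Real.pi)) = Real.exp (-L) ^ 2 by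
      rw [← Real.exp_nat_mul]; congr 1; push_cast; field_simp,
    show Real.exp (-2 * Real.pi * (1 / (L / Real.pi))) = p ^ 2 by
      rw [hp, ← Real.exp_nat_mul]; congr 1; push_cast; field_simp] at f2
  rw [show Real.exp (-2 * Real.pi * (2 * L / Real.pi)) = Real.exp (-L) ^ 4 by
      rw [← Real.exp_nat_mul]; congr 1; push_cast; field_simp; ring,
    show Real.exp (-2 * Real.pi * (1 / (2 * L / Real.pi))) = p by
      rw [hp]; congr 1; field_simp] at f4
  rw [gamma_eq_lambertSigma (Real.exp_pos _) (Real.exp_lt_one_iff.mpr (by linarith))]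
  field_simp at f1 f2 f4 ⊢
  linear_combination (1 / 3) * f1 - 2 * f2 + (2 / 3) * f4

theorem gamma_asymptotic :
    Filter.Tendsto
      (fun ν => Γ' ν /
        ((4 * Real.pi / Real.log (1 / ν)) ^ 2 * Real.exp (-Real.pi ^ 2 / Real.log (1 / ν))))
      (nhdsWithin 1 (Set.Iio 1)) (nhds 1) := by
  have hpi := Real.pi_pos
  have hmem : Set.Ioo (0 : ℝ) 1 ∈ 𝓝[<] (1 : ℝ) := Ioo_mem_nhdsLT one_pos
  have hL : Tendsto (fun ν : ℝ => Real.log (1 / ν)) (𝓝[<] 1) (𝓝[>] 0) := by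
    refine tendsto_nhdsWithin_iff.mpr ⟨?_, ?_⟩
    · have : ContinuousAt (fun ν : ℝ => Real.log (1 / ν)) 1 := by
        refine ContinuousAt.log (continuousAt_const.div continuousAt_id one_ne_zero) (by simp)
      simpa using this.tendsto.mono_left nhdsWithin_le_nhds
    · filter_upwards [hmem] with ν hν
      exact Real.log_pos (one_lt_one_div hν.1 hν.2)
  have hp : Tendsto (fun L : ℝ => Real.exp (-Real.pi ^ 2 / L)) (𝓝[>] 0) (𝓝[>] 0) := by
    refine tendsto_nhdsWithin_iff.mpr ⟨?_, Eventually.of_forall fun _ => Real.exp_pos _⟩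
    refine Real.tendsto_exp_atBot.comp ?_
    exact tendsto_inv_nhdsGT_zero.const_mul_atTop_of_neg (by nlinarith)
  have hid : Tendsto (fun p : ℝ => p) (𝓝[>] 0) (𝓝 0) := tendsto_id.mono_left nhdsWithin_le_nhds
  have hpow (n : ℕ) (hn : n ≠ 0) :
      Tendsto (fun p : ℝ => lambertSigma (p ^ n) / p ^ n) (𝓝[>] 0) (𝓝 1) := by
    refine tendsto_lambertSigma_div.comp (tendsto_nhdsWithin_iff.mpr ⟨?_, ?_⟩)
    · simpa [hn] using hid.pow n
    · filter_upwards [self_mem_nhdsWithin] with p hp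
      exact pow_pos (Set.mem_Ioi.mp hp) n
  have hmain := (tendsto_lambertSigma_div.sub (((hpow 2 two_ne_zero).mul hid).const_mul 3)).add
    (((hpow 4 four_ne_zero).mul (hid.pow 3)).const_mul 2)
  norm_num at hmain
  refine (hmain.comp (hp.comp hL)).congr' ?_
  filter_upwards [hmem] with ν hν
  have hLpos : 0 < Real.log (1 / ν) := Real.log_pos (one_lt_one_div hν.1 hν.2)
  have hexp : ν = Real.exp (-Real.log (1 / ν)) := by simp [Real.exp_log hν.1]
  have hg := gamma_exp_eq hLpos rfl
  rw [← hexp] at hg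
  rw [hg]
  have hppos := Real.exp_pos (-Real.pi ^ 2 / Real.log (1 / ν))
  simp only [Function.comp_apply]
  generalize Real.exp (-Real.pi ^ 2 / Real.log (1 / ν)) = p at *
  generalize Real.log (1 / ν) = L at *
  field_simp
  ring
end
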